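/- arXiv:2504.18280 — 2 statements merged into one kernel-verified Lean document; each statement's English description precedes it below -/
import Mathlib

section
/- Let w be a primitive π-clustering word over A = {a_1 < ... < a_d}. Suppose b = a_1, π⁻¹(a) = a_i and π⁻¹(b) = a_{i+1} for some 1 ≤ i < d. Then α_{a,b}(w) is π'-clustering over A for some permutation π' of A, where α_{a,b} is the morphism sending a to ab and fixing all other letters. -/
namespace BWTpaper

variable {A : Type*}

/-- Lexicographic `≤` (as a `Bool`) on lists, induced by a strict order `lt` on letters. -/
def lexLe (lt : A → A → Bool) : List A → List A → Bool
  | [], _ => true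
  | _ :: _, [] => false
  | x :: xs, y :: ys => if lt x y then true else if lt y x then false else lexLe lt xs ys

/-- The list of all rotations (conjugates, with multiplicity) of a word. -/
def rotations (w : List A) : List (List A) := (List.range w.length).map (fun i => w.rotate i)

/-- Burrows-Wheeler transform with respect to a strict order `lt` on letters. -/
def bwtBy (lt : A → A → Bool) (w : List A) : List A :=
  ((rotations w).mergeSort (lexLe lt)).filterMap List.getLast?

def stdLt [LinearOrder A] : A → A → Bool := fun x y => decide (x < y)

/-- Burrows-Wheeler transform w.r.t. the order of a `LinearOrder` alphabet. -/
def bwt [LinearOrder A] (w : List A) : List A := bwtBy stdLt w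

def Conjugate (u v : List A) : Prop := ∃ x y : List A, u = x ++ y ∧ v = y ++ x

/-- `u^p`. -/
def wordPow (u : List A) (p : ℕ) : List A := (List.replicate p u).flatten

def Primitive (w : List A) : Prop := w ≠ [] ∧ ∀ (u : List A) (k : ℕ), w = wordPow u k → k = 1

/-- The letters of the alphabet, sorted increasingly w.r.t. `lt`. -/
noncomputable def sortedAlphabet [Fintype A] (lt : A → A → Bool) : List A :=
  Finset.univ.toList.mergeSort (fun x y => !(lt y x))

/-- `w` is `π`-clustering w.r.t. the letter order `lt`:
its BWT is `π(a₁)^{k₁} ⋯ π(a_d)^{k_d}` where `a₁ < ⋯ < a_d` and `k_i = |w|_{π(a_i)}`. -/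
def IsClusteringBy [Fintype A] [DecidableEq A] (lt : A → A → Bool) (π : Equiv.Perm A)
    (w : List A) : Prop :=
  bwtBy lt w = (sortedAlphabet lt).flatMap (fun c => List.replicate (w.count (π c)) (π c))

def IsClustering [Fintype A] [LinearOrder A] (π : Equiv.Perm A) (w : List A) : Prop :=
  IsClusteringBy stdLt π w

/-- The prefix of length `n` of the periodic infinite word `u^ω`. -/
def omegaTake (u : List A) (n : ℕ) : List A := ((List.replicate n u).flatten).take n

/-- The ω-order: `u ≤_ω v` iff `u^ω ≤ v^ω` lexicographically (decided on the first
`|u| + |v|` letters, which suffices by Fine and Wilf). -/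
def omegaLe (lt : A → A → Bool) (u v : List A) : Bool :=
  lexLe lt (omegaTake u (u.length + v.length)) (omegaTake v (u.length + v.length))

/-- Extended Burrows-Wheeler transform of a multiset (list) of words. -/
def ebwtBy (lt : A → A → Bool) (W : List (List A)) : List A :=
  ((W.flatMap rotations).mergeSort (omegaLe lt)).filterMap List.getLast?

/-- A multiset of words is `π`-clustering if its eBWT consists of the blocks
`π(a₁)^{k₁} ⋯ π(a_d)^{k_d}` with `k_i` the total number of occurrences of `π(a_i)`. -/
def IsClusteringMultisetBy [Fintype A] [DecidableEq A] (lt : A → A → Bool)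
    (π : Equiv.Perm A) (W : List (List A)) : Prop :=
  ebwtBy lt W =
    (sortedAlphabet lt).flatMap
      (fun c => List.replicate ((W.map (fun w => w.count (π c))).sum) (π c))

/-- The morphism `α_{a,b} : a ↦ ab`, `c ↦ c` for `c ≠ a`. -/
def alphaM [DecidableEq A] (a b : A) (w : List A) : List A :=
  w.flatMap (fun c => if c = a then [a, b] else [c])

/-- The morphism `α̃_{a,b} : a ↦ ba`, `c ↦ c` for `c ≠ a`. -/
def tildeM [DecidableEq A] (a b : A) (w : List A) : List A :=
  w.flatMap (fun c => if c = a then [b, a] else [c])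


section LexOrder

variable [LinearOrder A]

theorem lexLe_stdLt_cons (x y : A) (xs ys : List A) :
    lexLe stdLt (x :: xs) (y :: ys) = true ↔ x < y ∨ x = y ∧ lexLe stdLt xs ys = true := by
  rcases lt_trichotomy x y with h | h | h
  · simp [lexLe, stdLt, h]
  · simp [lexLe, stdLt, h]
  · simp [lexLe, stdLt, h, h.not_gt, h.ne']

theorem lexLe_stdLt_total (u v : List A) : (lexLe stdLt u v || lexLe stdLt v u) = true := by
  induction u generalizing v with
  | nil => simp [lexLe]
  | cons x xs ih =>
    cases v with
    | nil => simp [lexLe]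
    | cons y ys =>
      have h := ih ys
      simp only [Bool.or_eq_true, lexLe_stdLt_cons] at h ⊢
      rcases lt_trichotomy x y with hxy | hxy | hxy <;> simp [hxy, h]

theorem lexLe_stdLt_trans (u v t : List A) (huv : lexLe stdLt u v = true)
    (hvt : lexLe stdLt v t = true) : lexLe stdLt u t = true := by
  induction u generalizing v t with
  | nil => simp [lexLe]
  | cons x xs ih =>
    cases v with
    | nil => simp [lexLe] at huv
    | cons y ys =>
      cases t with
      | nil => simp [lexLe] at hvt
      | cons z zs =>
        rw [lexLe_stdLt_cons] at huv hvt ⊢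
        rcases huv with h₁ | ⟨rfl, h₁⟩ <;> rcases hvt with h₂ | ⟨rfl, h₂⟩
        · exact Or.inl (h₁.trans h₂)
        · exact Or.inl h₁
        · exact Or.inl h₂
        · exact Or.inr ⟨rfl, ih _ _ h₁ h₂⟩

theorem lexLe_stdLt_antisymm (u v : List A) (huv : lexLe stdLt u v = true)
    (hvu : lexLe stdLt v u = true) : u = v := by
  induction u generalizing v with
  | nil =>
    cases v with
    | nil => rfl
    | cons y ys => simp [lexLe] at hvu
  | cons x xs ih =>
    cases v with
    | nil => simp [lexLe] at huv
    | cons y ys =>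
      rw [lexLe_stdLt_cons] at huv hvu
      rcases huv with h₁ | ⟨rfl, h₁⟩
      · rcases hvu with h₂ | ⟨rfl, -⟩
        · exact absurd h₂ h₁.not_gt
        · exact absurd h₁ (lt_irrefl _)
      · rcases hvu with h₂ | ⟨-, h₂⟩
        · exact absurd h₂ (lt_irrefl _)
        · rw [ih _ h₁ h₂]

theorem lexLe_stdLt_append_left (p u v : List A) (h : lexLe stdLt u v = true) :
    lexLe stdLt (p ++ u) (p ++ v) = true := by
  induction p with
  | nil => exact h
  | cons x p ih => exact (lexLe_stdLt_cons _ _ _ _).2 (Or.inr ⟨rfl, ih⟩)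

theorem lexLe_stdLt_of_append (p q u v : List A) (hlen : p.length = q.length)
    (h : lexLe stdLt (p ++ u) (q ++ v) = true) : lexLe stdLt p q = true := by
  induction p generalizing q with
  | nil => simp [lexLe]
  | cons x p ih =>
    cases q with
    | nil => simp at hlen
    | cons y q =>
      rw [List.cons_append, List.cons_append, lexLe_stdLt_cons] at h
      rw [lexLe_stdLt_cons]
      exact h.imp_right fun h => ⟨h.1, ih q (by simpa using hlen) h.2⟩

theorem mergeSort_lexLe_eq_of_perm {l s : List (List A)} (hperm : l.Perm s)
    (hs : s.Pairwise (fun u v => lexLe stdLt u v = true)) :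
    l.mergeSort (lexLe stdLt) = s :=
  ((List.mergeSort_perm l _).trans hperm).eq_of_pairwise
    (fun u v _ _ => lexLe_stdLt_antisymm u v)
    (List.pairwise_mergeSort lexLe_stdLt_trans lexLe_stdLt_total l) hs

end LexOrder

section Rotations

/-- The rotations of `x ++ y` starting at a letter of `y`. -/
def rotationsFrom : List A → List A → List (List A)
  | _, [] => []
  | x, c :: y => (c :: y ++ x) :: rotationsFrom (x ++ [c]) y

theorem map_rotate_range_eq_rotationsFrom (x y : List A) :
    (List.range y.length).map (fun i => (x ++ y).rotate (x.length + i)) = rotationsFrom x y := by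
  induction y generalizing x with
  | nil => rfl
  | cons c y ih =>
    rw [List.length_cons, List.range_succ_eq_map, List.map_cons, rotationsFrom, ← ih,
      List.map_map]
    congr 1
    · rw [Nat.add_zero, List.rotate_append_length_eq]
    · refine List.map_congr_left fun i _ => ?_
      simp [Nat.add_assoc, Nat.add_comm 1 i]

theorem rotations_eq_rotationsFrom (w : List A) : rotations w = rotationsFrom [] w := by
  rw [← map_rotate_range_eq_rotationsFrom]
  simp [rotations]

theorem mem_rotations_iff {u w : List A} : u ∈ rotations w ↔ ∃ i < w.length, w.rotate i = u := by
  simp [rotations]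

theorem perm_of_mem_rotations {u w : List A} (h : u ∈ rotations w) : u.Perm w := by
  obtain ⟨i, -, rfl⟩ := mem_rotations_iff.1 h
  exact List.rotate_perm w i

theorem append_singleton_mem_rotations {c : A} {u w : List A} (h : c :: u ∈ rotations w) :
    u ++ [c] ∈ rotations w := by
  obtain ⟨i, hi, h⟩ := mem_rotations_iff.1 h
  refine mem_rotations_iff.2 ⟨(i + 1) % w.length, Nat.mod_lt _ (by omega), ?_⟩
  rw [List.rotate_mod, ← List.rotate_rotate, h]
  simp

theorem filterMap_getLast?_rotationsFrom (x y : List A) (l : A) :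
    (rotationsFrom (x ++ [l]) y).filterMap List.getLast? = (l :: y).dropLast := by
  induction y generalizing x l with
  | nil => rfl
  | cons c y ih =>
    have h : (c :: y ++ (x ++ [l])).getLast? = some l := by
      rw [← List.append_assoc, List.getLast?_concat]
    rw [rotationsFrom, List.filterMap_cons_some h, ih]
    rfl

theorem filterMap_getLast?_rotations_perm (w : List A) :
    ((rotations w).filterMap List.getLast?).Perm w := by
  rw [rotations_eq_rotationsFrom]
  cases w with
  | nil => exact List.Perm.refl _
  | cons c y =>
    have h : (c :: y ++ []).getLast? = some ((c :: y).getLast (by simp)) := by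
      rw [List.append_nil, List.getLast?_eq_getLast_of_ne_nil]
    rw [rotationsFrom, List.filterMap_cons_some h, filterMap_getLast?_rotationsFrom [] y c]
    refine (List.perm_append_singleton _ _).symm.trans ?_
    rw [List.dropLast_append_getLast]

theorem bwtBy_perm (lt : A → A → Bool) (w : List A) : (bwtBy lt w).Perm w :=
  ((List.mergeSort_perm _ _).filterMap _).trans (filterMap_getLast?_rotations_perm w)

end Rotations

section Clustering

theorem sortedAlphabet_perm [Fintype A] (lt : A → A → Bool) :
    (sortedAlphabet lt).Perm Finset.univ.toList :=
  List.mergeSort_perm _ _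

theorem pairwise_sortedAlphabet_stdLt [Fintype A] [LinearOrder A] :
    (sortedAlphabet (stdLt (A := A))).Pairwise (· ≤ ·) := by
  have h := List.pairwise_mergeSort (le := fun x y : A => !(stdLt y x))
    (by simp only [stdLt, Bool.not_eq_true', decide_eq_false_iff_not, not_lt]
        exact fun _ _ _ => le_trans)
    (by simpa [stdLt] using fun x y : A => le_total x y)
    Finset.univ.toList
  simpa [sortedAlphabet, stdLt] using h

theorem flatMap_replicate_count_perm [Fintype A] [DecidableEq A] (lt : A → A → Bool)
    (π : Equiv.Perm A) (w : List A) :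
    ((sortedAlphabet lt).flatMap
      (fun c => List.replicate (w.count (π c)) (π c))).Perm w := by
  rw [List.perm_iff_count]
  intro x
  rw [List.count_flatMap, ((sortedAlphabet_perm lt).map _).sum_eq, Finset.sum_map_toList,
    Finset.sum_eq_single (π.symm x)]
  · simp
  · intro c _ hc
    have : π c ≠ x := fun h => hc (by simp [← h])
    simp [List.count_replicate, this]
  · simp

theorem isClustering_iff_pairwise [Fintype A] [LinearOrder A] (π : Equiv.Perm A) (w : List A) :
    IsClustering π w ↔ (bwt w).Pairwise (fun x y => π.symm x ≤ π.symm y) := by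
  have hblocks : ((sortedAlphabet stdLt).flatMap
      (fun c => List.replicate (w.count (π c)) (π c))).Pairwise
        (fun x y => π.symm x ≤ π.symm y) := by
    rw [List.pairwise_flatMap]
    refine ⟨fun c _ => List.pairwise_replicate_of_refl, ?_⟩
    refine pairwise_sortedAlphabet_stdLt.imp fun {c e} hce x hx y hy => ?_
    rw [List.eq_of_mem_replicate hx, List.eq_of_mem_replicate hy]
    simpa using hce
  refine ⟨fun h => ?_, fun h => ?_⟩
  · have h' : bwt w = _ := h
    rwa [h']
  · exact ((bwtBy_perm stdLt w).trans
      (flatMap_replicate_count_perm stdLt π w).symm).eq_of_pairwise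
      (fun x y _ _ hxy hyx => π.symm.injective (le_antisymm hxy hyx)) h hblocks

theorem pairwise_or_swap_of_mem {R : A → A → Prop} {l : List A} (hl : l.Pairwise R) {x y : A}
    (hx : x ∈ l) (hy : y ∈ l) (hxy : x ≠ y) : R x y ∨ R y x := by
  have : Std.Symm fun x y => R x y ∨ R y x := ⟨fun _ _ => Or.symm⟩
  exact (hl.imp (S := fun x y => R x y ∨ R y x) Or.inl).forall hx hy hxy

theorem lexLe_of_isClustering [Fintype A] [LinearOrder A] {π : Equiv.Perm A} {w : List A}
    (hcl : IsClustering π w) {u v : List A} {a b : A} (hu : u ++ [a] ∈ rotations w)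
    (hv : v ++ [b] ∈ rotations w) (hab : π.symm a < π.symm b) :
    lexLe stdLt (u ++ [a]) (v ++ [b]) = true := by
  have hlast := (isClustering_iff_pairwise π w).1 hcl
  rw [bwt, bwtBy, List.pairwise_filterMap] at hlast
  have hpair := (List.pairwise_mergeSort lexLe_stdLt_trans lexLe_stdLt_total
    (rotations w)).and hlast
  have hne : u ++ [a] ≠ v ++ [b] := by
    intro h
    have : a = b := by simpa using congrArg List.getLast? h
    exact hab.ne (congrArg π.symm this)
  rcases pairwise_or_swap_of_mem hpair (List.mem_mergeSort.2 hu) (List.mem_mergeSort.2 hv) hne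
    with h | h
  · exact h.1
  · exact absurd (h.2 b (by simp) a (by simp)) hab.not_ge

end Clustering

section AlphaMorphism

theorem alphaM_append [DecidableEq A] (a b : A) (u v : List A) :
    alphaM a b (u ++ v) = alphaM a b u ++ alphaM a b v := by
  simp [alphaM]

theorem alphaM_cons_self [DecidableEq A] (a b : A) (u : List A) :
    alphaM a b (a :: u) = a :: b :: alphaM a b u := by
  simp [alphaM]

theorem alphaM_cons_of_ne [DecidableEq A] {a b c : A} (h : c ≠ a) (u : List A) :
    alphaM a b (c :: u) = c :: alphaM a b u := by
  simp [alphaM, h]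

theorem exists_alphaM_cons [DecidableEq A] (a b c : A) (u : List A) :
    ∃ v, alphaM a b (c :: u) = c :: v := by
  by_cases h : c = a
  · exact h ▸ ⟨_, alphaM_cons_self _ _ _⟩
  · exact ⟨_, alphaM_cons_of_ne h _⟩

theorem getLast?_alphaM [DecidableEq A] (a b : A) (u : List A) :
    (alphaM a b u).getLast? = u.getLast?.map (fun c => if c = a then b else c) := by
  induction u using List.reverseRecOn with
  | nil => rfl
  | append_singleton u c _ =>
    rw [alphaM_append]
    by_cases h : c = a <;> simp [alphaM, h]

theorem lexLe_alphaM [LinearOrder A] (a b : A) (u v : List A) (h : lexLe stdLt u v = true) :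
    lexLe stdLt (alphaM a b u) (alphaM a b v) = true := by
  induction u generalizing v with
  | nil => simp [alphaM, lexLe]
  | cons x u ih =>
    cases v with
    | nil => simp [lexLe] at h
    | cons y v =>
      rcases (lexLe_stdLt_cons _ _ _ _).1 h with hxy | ⟨rfl, huv⟩
      · obtain ⟨u', hu'⟩ := exists_alphaM_cons a b x u
        obtain ⟨v', hv'⟩ := exists_alphaM_cons a b y v
        rw [hu', hv', lexLe_stdLt_cons]
        exact Or.inl hxy
      · rw [← List.singleton_append (l := u), ← List.singleton_append (l := v), alphaM_append,
          alphaM_append]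
        exact lexLe_stdLt_append_left _ _ _ (ih v huv)

/-- The rotation of `alphaM a b (a :: x)` starting at the letter `b` inserted after the first `a`,
for a word of the form `a :: x`; undefined on words not starting with `a`. -/
def innerRotation [DecidableEq A] (a b : A) : List A → Option (List A)
  | [] => none
  | c :: x => if c = a then some (b :: alphaM a b x ++ [a]) else none

theorem innerRotation_eq_some_iff [DecidableEq A] {a b : A} {u v : List A} :
    innerRotation a b u = some v ↔ ∃ x, u = a :: x ∧ v = b :: alphaM a b x ++ [a] := by
  cases u with
  | nil => simp [innerRotation]
  | cons c x =>
    by_cases h : c = a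
    · simp [innerRotation, h, eq_comm]
    · simp [innerRotation, h]

theorem rotationsFrom_alphaM_perm [DecidableEq A] (a b : A) (x y : List A) :
    (rotationsFrom (alphaM a b x) (alphaM a b y)).Perm
      ((rotationsFrom x y).filterMap (innerRotation a b) ++
        (rotationsFrom x y).map (alphaM a b)) := by
  induction y generalizing x with
  | nil => exact List.Perm.refl _
  | cons c y ih =>
    have h := ih (x ++ [c])
    by_cases hc : c = a
    · subst hc
      have hx : alphaM c b (x ++ [c]) = alphaM c b x ++ [c] ++ [b] := by
        simp [alphaM]
      rw [hx] at h
      simp only [alphaM_cons_self, rotationsFrom, List.map_cons, List.cons_append]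
      rw [List.filterMap_cons_some (b := b :: alphaM c b (y ++ x) ++ [c])
        (by simp [innerRotation])]
      rw [alphaM_append]
      refine (List.Perm.swap _ _ _).trans ?_
      simp only [List.cons_append, List.append_assoc] at h ⊢
      refine List.Perm.cons _ ?_
      exact (h.cons _).trans List.perm_middle.symm
    · have hx : alphaM a b (x ++ [c]) = alphaM a b x ++ [c] := by
        simp [alphaM, hc]
      rw [hx] at h
      simp only [alphaM_cons_of_ne hc, rotationsFrom, List.map_cons, List.cons_append]
      rw [List.filterMap_cons_none (by simp [innerRotation, hc]), alphaM_append]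
      exact (h.cons _).trans List.perm_middle.symm

theorem rotations_alphaM_perm [DecidableEq A] (a b : A) (w : List A) :
    (rotations (alphaM a b w)).Perm
      ((rotations w).filterMap (innerRotation a b) ++ (rotations w).map (alphaM a b)) := by
  rw [rotations_eq_rotationsFrom, rotations_eq_rotationsFrom]
  exact rotationsFrom_alphaM_perm a b [] w

theorem length_alphaM_eq_of_perm [DecidableEq A] (a b : A) {u v : List A} (h : u.Perm v) :
    (alphaM a b u).length = (alphaM a b v).length :=
  (h.flatMap_right _).length_eq

theorem lexLe_innerRotation_alphaM [Fintype A] [LinearOrder A] {π : Equiv.Perm A} {a b : A}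
    {w : List A} (hcl : IsClustering π w) (hab : π.symm a < π.symm b) (hmin : ∀ c, b ≤ c)
    {x v : List A} (hx : a :: x ∈ rotations w) (hv : v ∈ rotations w) :
    lexLe stdLt (b :: alphaM a b x ++ [a]) (alphaM a b v) = true := by
  have hne : b ≠ a := fun h => hab.ne (congrArg π.symm h.symm)
  cases v with
  | nil => exact absurd (perm_of_mem_rotations hx |>.trans
      (perm_of_mem_rotations hv).symm).length_eq (by simp)
  | cons c y =>
    rcases (hmin c).lt_or_eq with hc | rfl
    · obtain ⟨v', hv'⟩ := exists_alphaM_cons a b c y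
      rw [hv', List.cons_append, lexLe_stdLt_cons]
      exact Or.inl hc
    · have hx' := append_singleton_mem_rotations hx
      have hv' := append_singleton_mem_rotations hv
      have hle := lexLe_alphaM a b _ _ (lexLe_of_isClustering hcl hx' hv' hab)
      have hlen := length_alphaM_eq_of_perm a b
        ((perm_of_mem_rotations hx').trans (perm_of_mem_rotations hv').symm)
      have ha : alphaM a b (x ++ [a]) = (alphaM a b x ++ [a]) ++ [b] := by simp [alphaM]
      have hb : alphaM a b (y ++ [b]) = alphaM a b y ++ [b] := by simp [alphaM, hne]
      rw [ha, hb] at hle hlen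
      rw [alphaM_cons_of_ne hne, List.cons_append, lexLe_stdLt_cons]
      exact Or.inr ⟨rfl, lexLe_stdLt_of_append _ _ _ _ (by simpa using hlen) hle⟩

theorem bwt_alphaM [Fintype A] [LinearOrder A] {π : Equiv.Perm A} {a b : A}
    {w : List A} (hcl : IsClustering π w) (hab : π.symm a < π.symm b) (hmin : ∀ c, b ≤ c) :
    ∃ k, bwt (alphaM a b w) =
      List.replicate k a ++ (bwt w).map (fun c => if c = a then b else c) := by
  set inner := ((rotations w).filterMap (innerRotation a b)).mergeSort (lexLe stdLt) with hinner
  set S := (rotations w).mergeSort (lexLe stdLt)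
  have hmem : ∀ p ∈ inner, ∃ x, a :: x ∈ rotations w ∧ p = b :: alphaM a b x ++ [a] := by
    intro p hp
    rw [hinner, List.mem_mergeSort, List.mem_filterMap] at hp
    obtain ⟨u, hu, hup⟩ := hp
    obtain ⟨x, rfl, rfl⟩ := innerRotation_eq_some_iff.1 hup
    exact ⟨x, hu, rfl⟩
  have hsort : (rotations (alphaM a b w)).mergeSort (lexLe stdLt) = inner ++ S.map (alphaM a b) := by
    refine mergeSort_lexLe_eq_of_perm ((rotations_alphaM_perm a b w).trans
      ((List.mergeSort_perm _ _).symm.append ((List.mergeSort_perm _ _).symm.map _))) ?_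
    refine List.pairwise_append.2
      ⟨List.pairwise_mergeSort lexLe_stdLt_trans lexLe_stdLt_total _, ?_, ?_⟩
    · exact List.pairwise_map.2 ((List.pairwise_mergeSort lexLe_stdLt_trans lexLe_stdLt_total
        _).imp (lexLe_alphaM a b _ _))
    · intro p hp q hq
      obtain ⟨x, hx, rfl⟩ := hmem p hp
      obtain ⟨v, hv, rfl⟩ := List.mem_map.1 hq
      exact lexLe_innerRotation_alphaM hcl hab hmin hx (List.mem_mergeSort.1 hv)
  refine ⟨(inner.filterMap List.getLast?).length, ?_⟩
  rw [bwt, bwtBy, hsort, List.filterMap_append, List.filterMap_map, bwt, bwtBy, List.map_filterMap]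
  congr 1
  · refine List.eq_replicate_length.2 fun c hc => ?_
    obtain ⟨p, hp, hpc⟩ := List.mem_filterMap.1 hc
    obtain ⟨x, -, rfl⟩ := hmem p hp
    rw [List.getLast?_concat, Option.some_inj] at hpc
    exact hpc.symm
  · exact List.filterMap_congr fun u _ => getLast?_alphaM a b u

end AlphaMorphism

theorem coe_cycleRange_ite_succ {d : ℕ} {i : Fin d} (hi : (i : ℕ) + 1 < d) (j : Fin d) :
    (i.cycleRange (if j = i then ⟨(i : ℕ) + 1, hi⟩ else j) : ℕ) =
      if j ≤ i then (j : ℕ) + 1 else j := by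
  rcases lt_trichotomy j i with h | rfl | h
  · rw [if_neg h.ne, if_pos h.le, Fin.coe_cycleRange_of_lt h]
  · rw [if_pos rfl, if_pos le_rfl, Fin.cycleRange_of_gt (by simp [Fin.lt_def])]
  · rw [if_neg h.ne', if_neg h.not_ge, Fin.cycleRange_of_gt h]

/-- Lemma (case 2): if `w` is primitive and `π`-clustering over `A = {a₁ < ⋯ < a_d}`,
`b = a₁`, `π⁻¹(a) = a_i` and `π⁻¹(b) = a_{i+1}` with `1 ≤ i < d`, then `α_{a,b}(w)` is
`π'`-clustering over `A` for some permutation `π'`. -/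
theorem clustering_alpha_firstLetter (d : ℕ) (π : Equiv.Perm (Fin d)) (a b : Fin d)
    (hab : a ≠ b) (w : List (Fin d)) (hprim : Primitive w) (hcl : IsClustering π w)
    (i : Fin d) (hi : (i : ℕ) + 1 < d)
    (hb : (b : ℕ) = 0) (hia : π.symm a = i) (hib : π.symm b = ⟨(i : ℕ) + 1, hi⟩) :
    ∃ π' : Equiv.Perm (Fin d), IsClustering π' (alphaM a b w) := by
  have : NeZero d := ⟨by omega⟩
  have hlt : π.symm a < π.symm b := by
    rw [hia, hib, Fin.lt_def]
    simp
  obtain ⟨k, hk⟩ := bwt_alphaM hcl hlt fun c => by simp [Fin.le_def, hb]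
  refine ⟨i.cycleRange.symm.trans π, (isClustering_iff_pairwise _ _).2 ?_⟩
  have hmove : ∀ c, π.symm (if c = a then b else c) =
      if π.symm c = i then ⟨(i : ℕ) + 1, hi⟩ else π.symm c := by
    intro c
    have hc : π.symm c = i ↔ c = a := by rw [← hia, π.symm.injective.eq_iff]
    split_ifs <;> simp_all
  rw [hk, List.pairwise_append]
  refine ⟨List.pairwise_replicate_of_refl, ?_, ?_⟩
  · refine List.pairwise_map.2 (((isClustering_iff_pairwise π w).1 hcl).imp fun {x y} hxy => ?_)
    rw [Equiv.symm_trans_apply, Equiv.symm_trans_apply, Equiv.symm_symm, hmove, hmove, Fin.le_def,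
      coe_cycleRange_ite_succ, coe_cycleRange_ite_succ]
    rw [Fin.le_def] at hxy
    split_ifs <;> simp only [Fin.le_def] at * <;> omega
  · intro x hx y _
    rw [List.eq_of_mem_replicate hx]
    simp [hia, Fin.cycleRange_self]

end BWTpaper
end

section
/- Powers of the morphism images: if θ is a composition of the elementary morphisms α_{a,b} (a ↦ ab) and α̃_{a,b} (a ↦ ba) over an alphabet A, then θ is injective on A* and sends primitive words to primitive words. -/
namespace BWTpaper

variable {A : Type*}

theorem wordPow_succ (u : List A) (k : ℕ) : wordPow u (k + 1) = u ++ wordPow u k := by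
  simp [wordPow, List.replicate_succ]

theorem wordPow_succ' (u : List A) (k : ℕ) : wordPow u (k + 1) = wordPow u k ++ u := by
  simp [wordPow, List.replicate_succ']

theorem alphaM_wordPow [DecidableEq A] (a b : A) (u : List A) (k : ℕ) :
    alphaM a b (wordPow u k) = wordPow (alphaM a b u) k := by
  induction k with
  | zero => simp [wordPow, alphaM]
  | succ k ih => rw [wordPow_succ, alphaM_append, ih, wordPow_succ]

theorem wordPow_reverse (u : List A) (k : ℕ) :
    (wordPow u k).reverse = wordPow u.reverse k := by
  simp [wordPow, List.reverse_flatten]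

theorem Primitive.reverse {w : List A} (hw : Primitive w) : Primitive w.reverse := by
  refine ⟨by simpa using hw.1, fun u k h => hw.2 u.reverse k ?_⟩
  rw [← wordPow_reverse, ← h, List.reverse_reverse]

theorem alphaM_injective [DecidableEq A] (a b : A) :
    Function.Injective (alphaM a b) := by
  intro u
  induction u with
  | nil =>
    rintro (_ | ⟨y, v⟩) h
    · rfl
    · by_cases hy : y = a <;> simp [alphaM, hy] at h
  | cons x u ih =>
    rintro (_ | ⟨y, v⟩) h
    · by_cases hx : x = a <;> simp [alphaM, hx] at h
    · have key : x = y ∧ alphaM a b u = alphaM a b v := by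
        by_cases hx : x = a <;> by_cases hy : y = a <;>
          simp only [alphaM, List.flatMap_cons, hx, hy, if_true, if_false, List.cons_append,
            List.nil_append, List.cons.injEq] at h ⊢ <;> grind
      rw [key.1, ih key.2]

/-- No word in the image of `α_{a,b}` ends with the letter `a`. -/
theorem alphaM_ne_append_singleton [DecidableEq A] {a b : A} (hab : a ≠ b) (w v : List A) :
    alphaM a b w ≠ v ++ [a] := by
  intro h
  have hlast := congrArg List.getLast? h
  induction w using List.reverseRecOn with
  | nil => simp [alphaM] at h
  | append_singleton w c _ =>
    by_cases hc : c = a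
    · simp [alphaM, hc, List.getLast?_append] at hlast
      exact hab hlast.symm
    · simp [alphaM, hc] at hlast

/-- A prefix of `α_{a,b}(w)` that does not end with `a` is itself in the image of `α_{a,b}`. -/
theorem exists_alphaM_eq_of_prefix [DecidableEq A] {a b : A} {w u v : List A}
    (h : alphaM a b w = u ++ v) : (∃ u', alphaM a b u' = u) ∨ ∃ u₀, u = u₀ ++ [a] := by
  induction w generalizing u with
  | nil =>
    refine .inl ⟨[], ?_⟩
    simp only [alphaM, List.flatMap_nil, List.nil_eq, List.append_eq_nil_iff] at h
    simp [alphaM, h.1]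
  | cons c w ih =>
    have lift : ∀ {t : List A}, u = alphaM a b [c] ++ t → alphaM a b w = t ++ v →
        (∃ u', alphaM a b u' = u) ∨ ∃ u₀, u = u₀ ++ [a] := by
      rintro t rfl ht
      rcases ih ht with ⟨u', rfl⟩ | ⟨u₀, rfl⟩
      · exact .inl ⟨[c] ++ u', alphaM_append ..⟩
      · exact .inr ⟨alphaM a b [c] ++ u₀, by simp⟩
    rcases u with _ | ⟨x, u⟩
    · exact .inl ⟨[], rfl⟩
    by_cases hc : c = a
    · subst hc
      rcases u with _ | ⟨y, u⟩
      · refine .inr ⟨[], ?_⟩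
        simp [alphaM] at h
        simp [h.1]
      · simp [alphaM] at h
        exact lift (t := u) (by simp [alphaM, h.1, h.2.1]) h.2.2
    · simp [alphaM, hc] at h
      exact lift (t := u) (by simp [alphaM, hc, ← h.1]) h.2

theorem Primitive.alphaM [DecidableEq A] {a b : A} (hab : a ≠ b) {w : List A}
    (hw : Primitive w) : Primitive (alphaM a b w) := by
  refine ⟨fun h => hw.1 (alphaM_injective a b h), fun u k h => ?_⟩
  rcases k with _ | k
  · exact absurd (alphaM_injective a b h) hw.1
  rcases exists_alphaM_eq_of_prefix (h.trans (wordPow_succ u k)) with ⟨u', rfl⟩ | ⟨u₀, rfl⟩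
  · rw [← alphaM_wordPow] at h
    exact hw.2 u' _ (alphaM_injective a b h)
  · rw [wordPow_succ', ← List.append_assoc] at h
    exact absurd h (alphaM_ne_append_singleton hab _ _)

theorem tildeM_eq_reverse [DecidableEq A] (a b : A) (w : List A) :
    tildeM a b w = (alphaM a b w.reverse).reverse := by
  induction w with
  | nil => rfl
  | cons c w ih =>
    rw [List.reverse_cons, alphaM_append, List.reverse_append, ← ih]
    by_cases hc : c = a <;> simp [tildeM, BWTpaper.alphaM, hc]

theorem tildeM_injective [DecidableEq A] (a b : A) :
    Function.Injective (tildeM a b) := by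
  intro u v h
  rw [tildeM_eq_reverse, tildeM_eq_reverse] at h
  exact List.reverse_injective (alphaM_injective a b (List.reverse_injective h))

theorem Primitive.tildeM [DecidableEq A] {a b : A} (hab : a ≠ b) {w : List A}
    (hw : Primitive w) : Primitive (tildeM a b w) := by
  rw [tildeM_eq_reverse]
  exact (hw.reverse.alphaM hab).reverse

/-- Any finite composition of the elementary morphisms `α_{a,b} : a ↦ ab` and
`α̃_{a,b} : a ↦ ba` is injective on `A*` and sends primitive words to primitive words. -/
theorem composition_injective_primitive [DecidableEq A] (fs : List (List A → List A))
    (hfs : ∀ f ∈ fs, ∃ a b : A, a ≠ b ∧ (f = alphaM a b ∨ f = tildeM a b)) :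
    Function.Injective (fs.foldr (· ∘ ·) id) ∧
    ∀ w : List A, Primitive w → Primitive (fs.foldr (· ∘ ·) id w) := by
  induction fs with
  | nil => exact ⟨Function.injective_id, fun _ hw => hw⟩
  | cons f fs ih =>
    obtain ⟨hinj, hprim⟩ := ih fun g hg => hfs g (List.mem_cons_of_mem f hg)
    obtain ⟨a, b, hab, rfl | rfl⟩ := hfs f List.mem_cons_self
    · exact ⟨(alphaM_injective a b).comp hinj, fun w hw => (hprim w hw).alphaM hab⟩
    · exact ⟨(tildeM_injective a b).comp hinj, fun w hw => (hprim w hw).tildeM hab⟩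

end BWTpaper
end
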